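/- Suppose (q-1)/2 < k < q-1. Then dim(Hull(C_{n,k}^q)) = dim(C_{n,k}^q) − (2k + 1 − (q-1)) = C(n+k, k) − (2k + 1 − (q-1)). Moreover, a basis for Hull(C_{n,k}^q) is given by the evaluation vectors on P' of all monomials of degree k in x_0, x_1, …, x_n except the monomials x_{n-1}^{k-a} x_n^a for q-1-k ≤ a ≤ k. -/

import Mathlib

open scoped BigOperators

/-- A vector in `F^(n+1)` is a standard representative if its leftmost nonzero
coordinate equals `1`. -/
def IsStdRep {F : Type*} [Field F] {n : ℕ} (v : Fin (n + 1) → F) : Prop :=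
  ∃ i, (∀ j, j < i → v j = 0) ∧ v i = 1

/-- The set of standard affine representatives of the points of projective n-space. -/
abbrev ProjPts (F : Type*) [Field F] (n : ℕ) : Type _ :=
  {v : Fin (n + 1) → F // IsStdRep v}

noncomputable instance {F : Type*} [Field F] [Fintype F] {n : ℕ} :
    Fintype (ProjPts F n) := Fintype.ofFinite _

/-- Evaluation of a polynomial at the standard representatives, as a linear map. -/
noncomputable def evalOnPts (F : Type*) [Field F] [Fintype F] (n : ℕ) :
    MvPolynomial (Fin (n + 1)) F →ₗ[F] (ProjPts F n → F) where
  toFun f := fun p => MvPolynomial.eval p.1 f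
  map_add' f g := by ext p; simp
  map_smul' c f := by ext p; simp [MvPolynomial.smul_eval]

/-- The projective Reed–Muller code `C_{n,k}^q`: evaluations of homogeneous degree-`k`
polynomials at the standard representatives of the points of `ℙ^n(F)`. -/
noncomputable def PRM (F : Type*) [Field F] [Fintype F] (n k : ℕ) :
    Submodule F (ProjPts F n → F) :=
  Submodule.map (evalOnPts F n) (MvPolynomial.homogeneousSubmodule (Fin (n + 1)) F k)

/-- The dual code with respect to the standard bilinear form. -/
noncomputable def dualCode {F : Type*} [Field F] [Fintype F] {n : ℕ}
    (C : Submodule F (ProjPts F n → F)) : Submodule F (ProjPts F n → F) where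
  carrier := {y | ∀ c ∈ C, ∑ p : ProjPts F n, y p * c p = 0}
  zero_mem' := by intro c hc; simp
  add_mem' := by
    intro a b ha hb c hc
    show ∑ p : ProjPts F n, (a + b) p * c p = 0
    simp only [Pi.add_apply, add_mul, Finset.sum_add_distrib, ha c hc, hb c hc, add_zero]
  smul_mem' := by
    intro r a ha c hc
    show ∑ p : ProjPts F n, (r • a) p * c p = 0
    simp only [Pi.smul_apply, smul_eq_mul, mul_assoc, ← Finset.mul_sum, ha c hc, mul_zero]

open Finset

/-- The evaluation vector on `ProjPts F n` of the monomial with exponents `d`. -/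
def monoEval (F : Type*) [Field F] (n : ℕ) (d : Fin (n + 1) → ℕ) : ProjPts F n → F :=
  fun p => ∏ i, p.1 i ^ d i

/-- The exponents of the monomial `x_{n-1}^b x_n^a`. -/
def lastTwo (n a b : ℕ) : Fin (n + 1) → ℕ :=
  fun i => if (i : ℕ) = n then a else if (i : ℕ) = n - 1 then b else 0

section
variable {F : Type*} [Field F]

theorem isStdRep_cons_one {n : ℕ} (v : Fin (n + 1) → F) :
    IsStdRep (Fin.cons 1 v : Fin (n + 2) → F) :=
  ⟨0, by simp⟩

theorem isStdRep_cons_zero {n : ℕ} {v : Fin (n + 1) → F} (hv : IsStdRep v) :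
    IsStdRep (Fin.cons 0 v : Fin (n + 2) → F) := by
  obtain ⟨i, h0, h1⟩ := hv
  refine ⟨i.succ, fun j hj => ?_, by simpa using h1⟩
  cases j using Fin.cases with
  | zero => simp
  | succ j => simpa using h0 j (by simpa using hj)

/-- Projective space is the disjoint union of an affine space and a hyperplane at infinity. -/
def consPts (F : Type*) [Field F] (n : ℕ) :
    (Fin (n + 1) → F) ⊕ ProjPts F n → ProjPts F (n + 1)
  | .inl v => ⟨Fin.cons 1 v, isStdRep_cons_one v⟩
  | .inr p => ⟨Fin.cons 0 p.1, isStdRep_cons_zero p.2⟩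

theorem consPts_bijective (n : ℕ) : Function.Bijective (consPts F n) := by
  constructor
  · rintro (v | p) (w | r) h
    · simpa [consPts] using h
    · have := congrFun (Subtype.ext_iff.1 h) 0
      simp [consPts] at this
    · have := congrFun (Subtype.ext_iff.1 h) 0
      simp [consPts] at this
    · have := Subtype.ext_iff.1 h
      simp only [consPts, Fin.cons_right_injective _ |>.eq_iff] at this
      rw [Subtype.ext this]
  · rintro ⟨v, i, h0, h1⟩
    cases i using Fin.cases with
    | zero =>
      refine ⟨.inl (Fin.tail v), Subtype.ext ?_⟩
      change (Fin.cons 1 (Fin.tail v) : Fin (n + 2) → F) = v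
      rw [← h1, Fin.cons_self_tail]
    | succ i =>
      refine ⟨.inr ⟨Fin.tail v, i, fun j hj => h0 j.succ (by simpa using hj), h1⟩,
        Subtype.ext ?_⟩
      change (Fin.cons 0 (Fin.tail v) : Fin (n + 2) → F) = v
      rw [← h0 0 (Fin.succ_pos i), Fin.cons_self_tail]

theorem exists_smul_isStdRep {n : ℕ} {v : Fin (n + 1) → F} (hv : v ≠ 0) :
    ∃ (a : F) (w : Fin (n + 1) → F), IsStdRep w ∧ v = a • w := by
  classical
  have hne : ∃ i, v i ≠ 0 := Function.ne_iff.1 hv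
  have hs : (univ.filter fun i => v i ≠ 0).Nonempty := by
    simpa [Finset.Nonempty] using hne
  obtain ⟨i, hi, hmin⟩ := exists_minimal hs
  simp only [mem_filter, mem_univ, true_and] at hi hmin
  refine ⟨v i, (v i)⁻¹ • v, ⟨i, fun j hj => ?_, by simp [hi]⟩, by simp [smul_smul, hi]⟩
  have : v j = 0 := by
    by_contra h
    exact absurd (hmin h hj.le) (not_le.2 hj)
  simp [this]

/-- The Gram matrix of the exceptional monomials is nonsingular. -/
theorem eq_zero_of_gram {q k : ℕ} (hk1 : q - 1 < 2 * k) (hk2 : k < q - 1) {g : ℕ → F}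
    (hg : ∀ b ∈ Icc (q - 1 - k) k, ∑ a ∈ Icc (q - 1 - k) k,
      g a * ((if a + b = q - 1 then -1 else 0) + if a = k ∧ b = k then 1 else 0) = 0) :
    ∀ a ∈ Icc (q - 1 - k) k, g a = 0 := by
  have key : ∀ b ∈ Icc (q - 1 - k) k, -g (q - 1 - b) + (if b = k then g k else 0) = 0 := by
    intro b hb
    refine Eq.trans ?_ (hg b hb)
    simp only [mul_add, sum_add_distrib]
    rw [mem_Icc] at hb
    congr 1
    · rw [sum_eq_single_of_mem (q - 1 - b) (by rw [mem_Icc]; lia)]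
      · rw [if_pos (by lia)]
        simp
      · intro a _ ha
        rw [if_neg (by lia), mul_zero]
    · rw [sum_eq_single_of_mem k (by rw [mem_Icc]; lia)]
      · simp
      · intro a _ ha
        rw [if_neg (by tauto), mul_zero]
  have hk : ∀ a ∈ Icc (q - 1 - k) k, a ≠ q - 1 - k → g a = 0 := by
    intro a ha hne
    rw [mem_Icc] at ha
    have := key (q - 1 - a) (by rw [mem_Icc]; lia)
    rwa [if_neg (by lia), add_zero, neg_eq_zero, show q - 1 - (q - 1 - a) = a by lia] at this
  intro a ha
  by_cases h : a = q - 1 - k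
  · have := key k (by rw [mem_Icc]; lia)
    rwa [if_pos rfl, hk k (by rw [mem_Icc]; lia) (by lia), add_zero, neg_eq_zero, ← h] at this
  · exact hk a ha h

variable [Fintype F]

theorem sum_monoEval_zero (c : Fin 1 → ℕ) : ∑ p : ProjPts F 0, monoEval F 0 c p = 1 := by
  have key : ∀ p : ProjPts F 0, p = ⟨fun _ => 1, 0, by simp, rfl⟩ := by
    rintro ⟨v, i, -, h1⟩
    ext j
    rw [Subsingleton.elim (α := Fin 1) j i]
    exact h1
  rw [Fintype.sum_eq_single _ (fun p hp => absurd (key p) hp)]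
  simp [monoEval]

theorem sum_monoEval_succ (n : ℕ) (c : Fin (n + 2) → ℕ) :
    ∑ p : ProjPts F (n + 1), monoEval F (n + 1) c p =
      ∏ j : Fin (n + 1), ∑ x : F, x ^ c j.succ +
        0 ^ c 0 * ∑ p : ProjPts F n, monoEval F n (Fin.tail c) p := by
  classical
  rw [← (consPts_bijective (F := F) n).sum_comp, Fintype.sum_sum_type]
  congr 1
  · rw [Fintype.prod_sum]
    refine Fintype.sum_congr _ _ fun v => ?_
    simp [monoEval, consPts, Fin.prod_univ_succ]
  · rw [mul_sum]
    refine Fintype.sum_congr _ _ fun v => ?_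
    simp [monoEval, consPts, Fin.prod_univ_succ, Fin.tail]

theorem sum_pow_of_lt [DecidableEq F] {t : ℕ} (ht : t < 2 * (Fintype.card F - 1)) :
    ∑ x : F, x ^ t = if t = Fintype.card F - 1 then -1 else 0 := by
  rcases Nat.eq_zero_or_pos t with rfl | h
  · rw [FiniteField.sum_pow_lt_card_sub_one _ _ (by lia), if_neg (by lia)]
  · have hq : 0 < Fintype.card F - 1 := by lia
    have hunits : ∑ x : F, x ^ t = ∑ x : Fˣ, (x ^ t : F) := by
      rw [← Fintype.sum_subset (s := univ.map ⟨((↑) : Fˣ → F), Units.val_injective⟩), sum_map]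
      · rfl
      · intro x hx
        have hx0 : x ≠ 0 := fun h0 => hx (by rw [h0, zero_pow h.ne'])
        exact mem_map.2 ⟨Units.mk0 x hx0, mem_univ _, rfl⟩
    rw [hunits, FiniteField.sum_pow_units]
    refine if_congr ⟨?_, fun h => h ▸ dvd_rfl⟩ rfl rfl
    rintro ⟨r, rfl⟩
    have : r < 2 := by
      by_contra hr
      have := Nat.mul_le_mul_left (Fintype.card F - 1) (not_lt.1 hr)
      lia
    have : r ≠ 0 := by rintro rfl; simp at h
    rw [show r = 1 by lia, mul_one]

theorem sum_monoEval (m : ℕ) (c : Fin (m + 2) → ℕ)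
    (hc : ∑ i, c i < 2 * (Fintype.card F - 1)) :
    ∑ p : ProjPts F (m + 1), monoEval F (m + 1) c p =
      (∏ i : Fin m, (0 : F) ^ c i.castSucc.castSucc) *
        (∑ x : F, x ^ c (Fin.last _) + 0 ^ c (Fin.last m).castSucc) := by
  induction m with
  | zero => simp [sum_monoEval_succ, sum_monoEval_zero]
  | succ m ih =>
    rw [sum_monoEval_succ, ih]
    · have : ∏ j : Fin (m + 2), ∑ x : F, x ^ c j.succ = 0 := by
        by_contra hne
        have hge : ∀ j : Fin (m + 2), Fintype.card F - 1 ≤ c j.succ := by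
          intro j
          by_contra hlt
          exact hne (prod_eq_zero (mem_univ j)
            (FiniteField.sum_pow_lt_card_sub_one _ _ (not_le.1 hlt)))
        rw [Fin.sum_univ_succ, Fin.sum_univ_succ, Fin.sum_univ_succ] at hc
        have h0 := hge 0
        have h1 := hge (Fin.succ 0)
        lia
      rw [this, zero_add, Fin.prod_univ_succ, mul_assoc]
      rfl
    · rw [Fin.sum_univ_succ] at hc
      simp only [Fin.tail]
      lia

theorem eq_zero_of_evalOnPts_eq_zero {n k : ℕ} {f : MvPolynomial (Fin (n + 1)) F}
    (hf : f.IsHomogeneous k) (hk0 : k ≠ 0) (hk : k ≤ Fintype.card F)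
    (h : evalOnPts F n f = 0) : f = 0 := by
  refine hf.eq_zero_of_forall_eval_eq_zero_of_le_card (fun v => ?_) (by simpa using hk)
  have hsmul : ∀ (a : F) (w : Fin (n + 1) → F),
      MvPolynomial.eval (a • w) f = a ^ k * MvPolynomial.eval w f := by
    intro a w
    rw [MvPolynomial.eval_eq', MvPolynomial.eval_eq', mul_sum]
    refine sum_congr rfl fun d hd => ?_
    rw [hf.degree_eq_sum_deg_support hd, ← Finsupp.degree_apply, Finsupp.degree_eq_sum]
    simp only [Pi.smul_apply, smul_eq_mul, mul_pow, prod_mul_distrib, prod_pow_eq_pow_sum]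
    ring
  by_cases hv : v = 0
  · have := hsmul 0 0
    rw [zero_smul, zero_pow hk0, zero_mul] at this
    rw [hv, this]
  · obtain ⟨a, w, hw, rfl⟩ := exists_smul_isStdRep hv
    rw [hsmul, show MvPolynomial.eval w f = 0 from congrFun h ⟨w, hw⟩, mul_zero]

theorem evalOnPts_monomial {n : ℕ} (d : Fin (n + 1) → ℕ) (a : F) :
    evalOnPts F n (MvPolynomial.monomial (Finsupp.equivFunOnFinite.symm d) a) =
      a • monoEval F n d := by
  ext p
  simp [evalOnPts, monoEval, MvPolynomial.eval_monomial, Finsupp.prod_fintype]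

theorem linearIndependent_monoEval {n k : ℕ} (hk0 : k ≠ 0) (hk : k ≤ Fintype.card F) :
    LinearIndependent F
      (fun d : {d : Fin (n + 1) → ℕ // ∑ i, d i = k} => monoEval F n d.1) := by
  classical
  rw [linearIndependent_iff']
  intro s g hg d hd
  set f : MvPolynomial (Fin (n + 1)) F :=
    ∑ e ∈ s, MvPolynomial.monomial (Finsupp.equivFunOnFinite.symm e.1) (g e) with hf
  have hhom : f.IsHomogeneous k := MvPolynomial.IsHomogeneous.sum _ _ _ fun e _ =>
    MvPolynomial.isHomogeneous_monomial _ (by simpa [Finsupp.degree_eq_sum] using e.2)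
  have hf0 : f = 0 := eq_zero_of_evalOnPts_eq_zero hhom hk0 hk (by
    rw [hf, map_sum, ← hg]
    exact sum_congr rfl fun e _ => evalOnPts_monomial _ _)
  have := congrArg (MvPolynomial.coeff (Finsupp.equivFunOnFinite.symm d.1)) hf0
  rw [hf, MvPolynomial.coeff_sum] at this
  simpa [MvPolynomial.coeff_monomial, Subtype.ext_iff.symm, hd] using this

theorem span_monoEval (F : Type*) [Field F] [Fintype F] (n k : ℕ) :
    Submodule.span F (Set.range
      (fun d : {d : Fin (n + 1) → ℕ // ∑ i, d i = k} => monoEval F n d.1)) = PRM F n k := by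
  apply le_antisymm
  · rw [Submodule.span_le]
    rintro _ ⟨d, rfl⟩
    refine ⟨MvPolynomial.monomial (Finsupp.equivFunOnFinite.symm d.1) 1,
      MvPolynomial.isHomogeneous_monomial _ (by simpa [Finsupp.degree_eq_sum] using d.2), ?_⟩
    simpa using evalOnPts_monomial d.1 (1 : F)
  · rintro _ ⟨f, hf, rfl⟩
    rw [f.as_sum, map_sum]
    refine Submodule.sum_mem _ fun d hd => ?_
    have hdeg := (MvPolynomial.mem_homogeneousSubmodule _ _ |>.1 hf).degree_eq_sum_deg_support hd
    rw [← Finsupp.equivFunOnFinite.symm_apply_apply d, evalOnPts_monomial]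
    exact Submodule.smul_mem _ _ (Submodule.subset_span
      ⟨⟨d, by rw [hdeg, ← Finsupp.degree_apply, Finsupp.degree_eq_sum]⟩, rfl⟩)
theorem sum_monoEval_mul {n : ℕ} (d e : Fin (n + 1) → ℕ) :
    ∑ p : ProjPts F n, monoEval F n d p * monoEval F n e p =
      ∑ p : ProjPts F n, monoEval F n (d + e) p := by
  simp [monoEval, pow_add, prod_mul_distrib]

theorem monoEval_mem_PRM {n k : ℕ} {d : Fin (n + 1) → ℕ} (hd : ∑ i, d i = k) :
    monoEval F n d ∈ PRM F n k := by
  rw [← span_monoEval]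
  exact Submodule.subset_span ⟨⟨d, hd⟩, rfl⟩

@[simp] theorem lastTwo_last (m a b : ℕ) : lastTwo (m + 1) a b (Fin.last _) = a := by
  simp [lastTwo]

@[simp] theorem lastTwo_castSucc_last (m a b : ℕ) :
    lastTwo (m + 1) a b (Fin.last m).castSucc = b := by
  simp [lastTwo]

@[simp] theorem lastTwo_castSucc_castSucc {m : ℕ} (a b : ℕ) (i : Fin m) :
    lastTwo (m + 1) a b i.castSucc.castSucc = 0 := by
  have := i.2
  simp only [lastTwo, Fin.val_castSucc]
  rw [if_neg (by lia), if_neg (by lia)]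

theorem sum_lastTwo (m a b : ℕ) : ∑ i, lastTwo (m + 1) a b i = a + b := by
  rw [Fin.sum_univ_castSucc, Fin.sum_univ_castSucc]
  simp [add_comm]

theorem eq_lastTwo {m : ℕ} {d : Fin (m + 2) → ℕ} (h : ∀ i : Fin m, d i.castSucc.castSucc = 0) :
    d = lastTwo (m + 1) (d (Fin.last _)) (d (Fin.last m).castSucc) := by
  ext i
  refine Fin.lastCases (by simp) (fun i => ?_) i
  refine Fin.lastCases (by simp) (fun i => ?_) i
  simp [h]

theorem sum_monoEval_mul_eq_zero {m k : ℕ} (hk1 : Fintype.card F - 1 < 2 * k)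
    (hk2 : k < Fintype.card F - 1) {d e : Fin (m + 2) → ℕ} (hd : ∑ i, d i = k)
    (he : ∑ i, e i = k)
    (hex : ¬ ∃ a, Fintype.card F - 1 - k ≤ a ∧ a ≤ k ∧ d = lastTwo (m + 1) a (k - a)) :
    ∑ p : ProjPts F (m + 1), monoEval F (m + 1) d p * monoEval F (m + 1) e p = 0 := by
  rw [sum_monoEval_mul, sum_monoEval]
  swap
  · simp only [Pi.add_apply, sum_add_distrib, hd, he]
    lia
  by_contra hne
  obtain ⟨hprod, hlast⟩ := mul_ne_zero_iff.1 hne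
  have hz : ∀ i : Fin m, d i.castSucc.castSucc = 0 ∧ e i.castSucc.castSucc = 0 := by
    intro i
    have := prod_ne_zero_iff.1 hprod i (mem_univ i)
    by_contra h
    exact this (zero_pow (by simp only [Pi.add_apply]; lia))
  have hd2 := eq_lastTwo fun i => (hz i).1
  have he2 := eq_lastTwo fun i => (hz i).2
  rw [hd2, sum_lastTwo] at hd
  rw [he2, sum_lastTwo] at he
  have hlt : d (Fin.last _) < Fintype.card F - 1 - k := by
    by_contra h
    refine hex ⟨d (Fin.last _), not_lt.1 h, by lia, ?_⟩
    rwa [show k - d (Fin.last _) = d (Fin.last m).castSucc by lia]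
  apply hlast
  rw [FiniteField.sum_pow_lt_card_sub_one _ _ (by simp only [Pi.add_apply]; lia),
    zero_pow (by simp only [Pi.add_apply]; lia), zero_add]

theorem sum_monoEval_lastTwo_mul [DecidableEq F] {m k a b : ℕ}
    (hk2 : k < Fintype.card F - 1) (ha : a ≤ k) (hb : b ≤ k) :
    ∑ p : ProjPts F (m + 1), monoEval F (m + 1) (lastTwo (m + 1) a (k - a)) p *
        monoEval F (m + 1) (lastTwo (m + 1) b (k - b)) p =
      (if a + b = Fintype.card F - 1 then -1 else 0) + if a = k ∧ b = k then 1 else 0 := by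
  rw [sum_monoEval_mul, sum_monoEval]
  swap
  · simp only [Pi.add_apply, sum_add_distrib, sum_lastTwo]
    lia
  simp only [Pi.add_apply, lastTwo_last, lastTwo_castSucc_last, lastTwo_castSucc_castSucc,
    add_zero, pow_zero, prod_const_one, one_mul]
  rw [sum_pow_of_lt (by lia), zero_pow_eq]
  congr 1
  exact if_congr (by lia) rfl rfl

theorem mem_PRM_iff {n k : ℕ} {f : ProjPts F n → F} :
    f ∈ PRM F n k ↔ ∃ g : (Fin (n + 1) → ℕ) → F,
      f = ∑ d ∈ piAntidiag univ k, g d • monoEval F n d := by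
  constructor
  · intro hf
    rw [← span_monoEval] at hf
    have : Set.range (fun d : {d : Fin (n + 1) → ℕ // ∑ i, d i = k} => monoEval F n d.1) =
        monoEval F n '' (piAntidiag univ k : Finset (Fin (n + 1) → ℕ)) := by
      ext
      simp
    rw [this, Submodule.mem_span_image_finset_iff_exists_fun] at hf
    obtain ⟨g, hg⟩ := hf
    refine ⟨fun d => if h : d ∈ piAntidiag univ k then g ⟨d, h⟩ else 0, ?_⟩
    rw [← hg, ← sum_coe_sort (piAntidiag univ k)]
    exact sum_congr rfl fun d _ => by simp
  · rintro ⟨g, rfl⟩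
    exact Submodule.sum_mem _ fun d hd => Submodule.smul_mem _ _
      (monoEval_mem_PRM (mem_piAntidiag.1 hd).1)

theorem span_eq_hull [DecidableEq F] {m k : ℕ} (hk1 : Fintype.card F - 1 < 2 * k)
    (hk2 : k < Fintype.card F - 1) :
    Submodule.span F (Set.range
      (fun d : {d : Fin (m + 2) → ℕ // (∑ i, d i) = k ∧
          ¬ ∃ a, Fintype.card F - 1 - k ≤ a ∧ a ≤ k ∧ d = lastTwo (m + 1) a (k - a)} =>
        monoEval F (m + 1) d.1)) = PRM F (m + 1) k ⊓ dualCode (PRM F (m + 1) k) := by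
  apply le_antisymm
  · rw [Submodule.span_le]
    rintro _ ⟨⟨d, hd, hex⟩, rfl⟩
    refine ⟨monoEval_mem_PRM hd, fun f hf => ?_⟩
    obtain ⟨g, rfl⟩ := mem_PRM_iff.1 hf
    simp only [Finset.sum_apply, Pi.smul_apply, smul_eq_mul, mul_sum]
    rw [sum_comm]
    refine sum_eq_zero fun e he => ?_
    simp only [mul_left_comm _ (g e), ← mul_sum]
    rw [sum_monoEval_mul_eq_zero hk1 hk2 hd (mem_piAntidiag.1 he).1 hex, mul_zero]
  · rintro f ⟨hf, hdual⟩
    obtain ⟨g, rfl⟩ := mem_PRM_iff.1 hf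
    have hg : ∀ a ∈ Icc (Fintype.card F - 1 - k) k, g (lastTwo (m + 1) a (k - a)) = 0 := by
      refine eq_zero_of_gram (g := fun a => g (lastTwo (m + 1) a (k - a))) hk1 hk2 fun b hb => ?_
      rw [mem_Icc] at hb
      have hsum : ∀ a ≤ k, ∑ i, lastTwo (m + 1) a (k - a) i = k := fun a ha => by
        rw [sum_lastTwo, Nat.add_sub_cancel' ha]
      refine Eq.trans ?_ (hdual _ (monoEval_mem_PRM (hsum b hb.2)))
      simp only [Finset.sum_apply, Pi.smul_apply, smul_eq_mul, sum_mul]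
      rw [sum_comm]
      simp only [mul_assoc, ← mul_sum]
      refine sum_of_injOn (fun a => lastTwo (m + 1) a (k - a)) ?_ ?_ ?_ ?_
      · intro a _ a' _ h
        simpa using congrFun h (Fin.last _)
      · intro a ha
        rw [mem_coe, mem_Icc] at ha
        simpa using hsum a ha.2
      · intro d hd hnot
        rw [sum_monoEval_mul_eq_zero hk1 hk2 (mem_piAntidiag.1 hd).1 (hsum b hb.2), mul_zero]
        rintro ⟨a, h1, h2, rfl⟩
        exact hnot ⟨a, by simpa using ⟨by lia, h2⟩, rfl⟩
      · intro a ha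
        rw [mem_Icc] at ha
        rw [sum_monoEval_lastTwo_mul hk2 ha.2 hb.2]
    refine Submodule.sum_mem _ fun d hd => ?_
    by_cases hex : ∃ a, Fintype.card F - 1 - k ≤ a ∧ a ≤ k ∧ d = lastTwo (m + 1) a (k - a)
    · obtain ⟨a, h1, h2, rfl⟩ := hex
      rw [hg a (mem_Icc.2 ⟨h1, h2⟩), zero_smul]
      exact Submodule.zero_mem _
    · exact Submodule.smul_mem _ _
        (Submodule.subset_span ⟨⟨d, (mem_piAntidiag.1 hd).1, hex⟩, rfl⟩)

end

theorem card_exponents (n k : ℕ) :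
    Nat.card {d : Fin (n + 1) → ℕ // ∑ i, d i = k} = (n + k).choose k := by
  rw [← Nat.card_congr (Sym.equivNatSumOfFintype (Fin (n + 1)) k), Nat.card_eq_fintype_card,
    Sym.card_sym_eq_choose, Fintype.card_fin]
  congr 1
  lia

theorem card_ordinary_add_card_exceptional (m k l : ℕ) :
    Nat.card {d : Fin (m + 2) → ℕ // (∑ i, d i) = k ∧
        ¬ ∃ a, l ≤ a ∧ a ≤ k ∧ d = lastTwo (m + 1) a (k - a)} + (k + 1 - l) =
      Nat.card {d : Fin (m + 2) → ℕ // ∑ i, d i = k} := by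
  classical
  let S : Finset (Fin (m + 2) → ℕ) := piAntidiag univ k
  let T : Finset (Fin (m + 2) → ℕ) := (Icc l k).image fun a => lastTwo (m + 1) a (k - a)
  have hT : T ⊆ S := by
    intro d hd
    obtain ⟨a, ha, rfl⟩ := mem_image.1 hd
    rw [mem_Icc] at ha
    simp [S, sum_lastTwo, ha.2]
  have hTcard : T.card = k + 1 - l := by
    rw [card_image_of_injective, Nat.card_Icc]
    intro a a' h
    simpa using congrFun h (Fin.last _)
  have h1 : Nat.card {d : Fin (m + 2) → ℕ // ∑ i, d i = k} = S.card :=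
    Nat.subtype_card S (by simp [S])
  have h2 : Nat.card {d : Fin (m + 2) → ℕ // (∑ i, d i) = k ∧
      ¬ ∃ a, l ≤ a ∧ a ≤ k ∧ d = lastTwo (m + 1) a (k - a)} = (S \ T).card := by
    refine Nat.subtype_card _ fun d => ?_
    simp [S, T, and_assoc, eq_comm]
  rw [h1, h2, ← hTcard, card_sdiff_add_card_eq_card hT]

theorem finrank_PRM {F : Type*} [Field F] [Fintype F] {n k : ℕ} (hk0 : k ≠ 0)
    (hk : k ≤ Fintype.card F) :
    Module.finrank F (PRM F n k) = Nat.card {d : Fin (n + 1) → ℕ // ∑ i, d i = k} := by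
  have hli := linearIndependent_monoEval (F := F) (n := n) hk0 hk
  have := hli.finite
  have := Fintype.ofFinite {d : Fin (n + 1) → ℕ // ∑ i, d i = k}
  rw [← span_monoEval, finrank_span_eq_card hli, Nat.card_eq_fintype_card]

theorem linearIndependent_monoEval_subtype {F : Type*} [Field F] [Fintype F] {n k : ℕ}
    (hk0 : k ≠ 0) (hk : k ≤ Fintype.card F) (P : (Fin (n + 1) → ℕ) → Prop) :
    LinearIndependent F
      (fun d : {d : Fin (n + 1) → ℕ // ∑ i, d i = k ∧ P d} => monoEval F n d.1) :=
  (linearIndependent_monoEval hk0 hk).comp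
    (fun d : {d : Fin (n + 1) → ℕ // ∑ i, d i = k ∧ P d} => ⟨d.1, d.2.1⟩)
    fun _ _ h => Subtype.ext (congrArg (fun e => e.1) h)

theorem finrank_span_monoEval_subtype {F : Type*} [Field F] [Fintype F] {n k : ℕ}
    (hk0 : k ≠ 0) (hk : k ≤ Fintype.card F) (P : (Fin (n + 1) → ℕ) → Prop) :
    Module.finrank F (Submodule.span F (Set.range
      (fun d : {d : Fin (n + 1) → ℕ // ∑ i, d i = k ∧ P d} => monoEval F n d.1))) =
      Nat.card {d : Fin (n + 1) → ℕ // ∑ i, d i = k ∧ P d} := by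
  have hli := linearIndependent_monoEval_subtype hk0 hk P
  have := hli.finite
  have := Fintype.ofFinite {d : Fin (n + 1) → ℕ // ∑ i, d i = k ∧ P d}
  rw [finrank_span_eq_card hli, Nat.card_eq_fintype_card]

theorem stmt18 (q n : ℕ) (F : Type*) [Field F] [Fintype F] [DecidableEq F]
    (hq : Fintype.card F = q) (hn : 1 ≤ n) (k : ℕ) (hk1 : q - 1 < 2 * k) (hk2 : k < q - 1) :
    (Module.finrank F ↥(PRM F n k ⊓ dualCode (PRM F n k)) : ℤ) =
        (Module.finrank F (PRM F n k) : ℤ) - (2 * (k : ℤ) + 1 - ((q : ℤ) - 1)) ∧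
    Module.finrank F (PRM F n k) = (n + k).choose k ∧
    LinearIndependent F
      (fun d : {d : Fin (n + 1) → ℕ //
          (∑ i, d i) = k ∧
          ¬ ∃ a, q - 1 - k ≤ a ∧ a ≤ k ∧
            d = fun (i : Fin (n + 1)) => if (i : ℕ) = n then a else if (i : ℕ) = n - 1 then k - a else 0} =>
        (fun p : ProjPts F n => ∏ i, p.1 i ^ d.1 i)) ∧
    Submodule.span F
      (Set.range (fun d : {d : Fin (n + 1) → ℕ //
          (∑ i, d i) = k ∧
          ¬ ∃ a, q - 1 - k ≤ a ∧ a ≤ k ∧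
            d = fun (i : Fin (n + 1)) => if (i : ℕ) = n then a else if (i : ℕ) = n - 1 then k - a else 0} =>
        (fun p : ProjPts F n => ∏ i, p.1 i ^ d.1 i)))
      = PRM F n k ⊓ dualCode (PRM F n k) := by
  subst hq
  obtain ⟨m, rfl⟩ : ∃ m, n = m + 1 := ⟨n - 1, by lia⟩
  have hk0 : k ≠ 0 := by lia
  have hk : k ≤ Fintype.card F := by lia
  have hspan := span_eq_hull (F := F) (m := m) hk1 hk2
  have hdim := finrank_PRM (F := F) (n := m + 1) hk0 hk
  refine ⟨?_, hdim.trans (card_exponents _ _), linearIndependent_monoEval_subtype hk0 hk _, hspan⟩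
  have := card_ordinary_add_card_exceptional m k (Fintype.card F - 1 - k)
  rw [hdim, ← hspan, finrank_span_monoEval_subtype hk0 hk]
  lia
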